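/- arXiv:2503.18517 — 3 statements merged into one kernel-verified Lean document; each statement's English description precedes it below -/
import Mathlib

section
/- Let α > 0 be a real number with α ∉ √2·ℚ, with H₄-expansion data G_n = (t_n, v_n; u_n, w_n), α_n = (w_n·α − v_n)/(t_n − u_n·α), α*_n = w_n/u_n. For every n ≥ m(α)+1 one has u_n·|u_n·α − t_n| = 1/(α_n + α*_n) and w_n·|w_n·α − v_n| = 1/(α_n⁻¹ + (α*_n)⁻¹). -/
/-- A matrix (p, r; q, s) has the first H4 form (without sign). -/
def H4form (p r q s : ℝ) : Prop :=
  (∃ a b c d : ℤ, Odd a ∧ Odd d ∧ a * d - 2 * b * c = 1 ∧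
     p = (a : ℝ) ∧ r = Real.sqrt 2 * b ∧ q = Real.sqrt 2 * c ∧ s = (d : ℝ)) ∨
  (∃ a b c d : ℤ, Odd b ∧ Odd c ∧ 2 * a * d - b * c = 1 ∧
     p = Real.sqrt 2 * a ∧ r = (b : ℝ) ∧ q = (c : ℝ) ∧ s = Real.sqrt 2 * d)

/-- The matrix (p, r; q, s) belongs to the Hecke group H4 (up to sign). -/
def H4 (p r q s : ℝ) : Prop := H4form p r q s ∨ H4form (-p) (-r) (-q) (-s)

/-- p/q ∈ ℚ(H₄): q > 0 and (p, r; q, s) ∈ H₄ for some reals r, s. -/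
def QH4 (p q : ℝ) : Prop := 0 < q ∧ ∃ r s : ℝ, H4 p r q s

/-- α ∉ √2·ℚ. -/
def NotSqrt2Rat (α : ℝ) : Prop := ¬ ∃ x : ℚ, α = Real.sqrt 2 * (x : ℝ)

/-- The matrices A₁, A₂, A₃ generating the H₄-expansion. -/
noncomputable def Amat : ℕ → Matrix (Fin 2) (Fin 2) ℝ
  | 1 => !![1, 0; Real.sqrt 2, 1]
  | 2 => !![Real.sqrt 2, 1; 1, Real.sqrt 2]
  | _ => !![1, Real.sqrt 2; 0, 1]

/-- G_n = A_{d₁} ⋯ A_{d_n}. -/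
noncomputable def Gmat (d : ℕ → ℕ) (n : ℕ) : Matrix (Fin 2) (Fin 2) ℝ :=
  ((List.range n).map (fun i => Amat (d (i + 1)))).prod

noncomputable def tn (d : ℕ → ℕ) (n : ℕ) : ℝ := Gmat d n 0 0
noncomputable def vn (d : ℕ → ℕ) (n : ℕ) : ℝ := Gmat d n 0 1
noncomputable def un (d : ℕ → ℕ) (n : ℕ) : ℝ := Gmat d n 1 0
noncomputable def wn (d : ℕ → ℕ) (n : ℕ) : ℝ := Gmat d n 1 1

/-- α_n = G_n⁻¹ · α. -/
noncomputable def alphan (d : ℕ → ℕ) (α : ℝ) (n : ℕ) : ℝ :=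
  (wn d n * α - vn d n) / (tn d n - un d n * α)

/-- α*_n = w_n / u_n. -/
noncomputable def alphast (d : ℕ → ℕ) (n : ℕ) : ℝ := wn d n / un d n

theorem Amat_cases (k : ℕ) :
    Amat k = !![1, 0; Real.sqrt 2, 1] ∨ Amat k = !![Real.sqrt 2, 1; 1, Real.sqrt 2] ∨
      Amat k = !![1, Real.sqrt 2; 0, 1] := by
  unfold Amat
  split <;> simp

theorem det_Amat (k : ℕ) : (Amat k).det = 1 := by
  have h2 : Real.sqrt 2 * Real.sqrt 2 = 2 := Real.mul_self_sqrt (by norm_num)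
  rcases Amat_cases k with h | h | h <;> rw [h, Matrix.det_fin_two_of] <;> linarith

theorem Gmat_succ (d : ℕ → ℕ) (n : ℕ) : Gmat d (n + 1) = Gmat d n * Amat (d (n + 1)) := by
  simp [Gmat, List.range_succ]

theorem det_Gmat (d : ℕ → ℕ) (n : ℕ) : (Gmat d n).det = 1 := by
  induction n with
  | zero => simp [Gmat]
  | succ n ih => rw [Gmat_succ, Matrix.det_mul, ih, det_Amat, one_mul]

theorem tn_mul_wn_sub (d : ℕ → ℕ) (n : ℕ) : tn d n * wn d n - vn d n * un d n = 1 := by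
  rw [← det_Gmat d n, Matrix.det_fin_two]
  rfl

theorem un_succ (d : ℕ → ℕ) (n : ℕ) :
    un d (n + 1) = un d n * Amat (d (n + 1)) 0 0 + wn d n * Amat (d (n + 1)) 1 0 := by
  simp [un, wn, Gmat_succ, Matrix.mul_apply, Fin.sum_univ_two]

theorem wn_succ (d : ℕ → ℕ) (n : ℕ) :
    wn d (n + 1) = un d n * Amat (d (n + 1)) 0 1 + wn d n * Amat (d (n + 1)) 1 1 := by
  simp [un, wn, Gmat_succ, Matrix.mul_apply, Fin.sum_univ_two]

theorem un_nonneg_and_wn_pos (d : ℕ → ℕ) (n : ℕ) : 0 ≤ un d n ∧ 0 < wn d n := by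
  induction n with
  | zero => simp [un, wn, Gmat]
  | succ n ih =>
    obtain ⟨hu, hw⟩ := ih
    rw [un_succ, wn_succ]
    rcases Amat_cases (d (n + 1)) with h | h | h <;> rw [h] <;> constructor <;> simp <;> positivity

theorem un_pos (d : ℕ → ℕ) {m : ℕ} (hm : d (m + 1) = 1 ∨ d (m + 1) = 2) {n : ℕ}
    (hn : m + 1 ≤ n) : 0 < un d n := by
  induction n, hn using Nat.le_induction with
  | base =>
    obtain ⟨hu, hw⟩ := un_nonneg_and_wn_pos d m
    rw [un_succ]
    rcases hm with h | h <;> rw [h] <;> simp [Amat] <;> positivity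
  | succ n _ ih =>
    have hw := (un_nonneg_and_wn_pos d n).2
    rw [un_succ]
    rcases Amat_cases (d (n + 1)) with h | h | h <;> rw [h] <;> simp <;> positivity

theorem approximation_identities (α : ℝ) (hα : 0 < α) (hirr : NotSqrt2Rat α)
    (d : ℕ → ℕ)
    (hd : ∀ n : ℕ, 1 ≤ n → d n = 1 ∨ d n = 2 ∨ d n = 3)
    (hmem : ∀ n : ℕ, 1 ≤ n → vn d n < wn d n * α ∧ un d n * α < tn d n)
    (m : ℕ) (hm : ∀ n : ℕ, 1 ≤ n → n ≤ m → d n = 3) (hm1 : d (m + 1) ≠ 3)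
    (n : ℕ) (hn : m + 1 ≤ n) :
    un d n * |un d n * α - tn d n| = 1 / (alphan d α n + alphast d n) ∧
    wn d n * |wn d n * α - vn d n| = 1 / ((alphan d α n)⁻¹ + (alphast d n)⁻¹) := by
  have hu : 0 < un d n := un_pos d (by have := hd (m + 1) (by omega); tauto) hn
  have hw : 0 < wn d n := (un_nonneg_and_wn_pos d n).2
  have hdet := tn_mul_wn_sub d n
  obtain ⟨hv, ht⟩ := hmem n (by omega)
  have hX : 0 < wn d n * α - vn d n := sub_pos.2 hv
  have hY : 0 < tn d n - un d n * α := sub_pos.2 ht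
  rw [abs_sub_comm, abs_of_pos hY, abs_of_pos hX]
  unfold alphan alphast
  have key : un d n * (wn d n * α - vn d n) + wn d n * (tn d n - un d n * α) = 1 := by
    linear_combination hdet
  generalize wn d n * α - vn d n = X at *
  generalize tn d n - un d n * α = Y at *
  have h1 : X / Y + wn d n / un d n = 1 / (un d n * Y) := by
    field_simp
    linear_combination key
  have h2 : (X / Y)⁻¹ + (wn d n / un d n)⁻¹ = 1 / (wn d n * X) := by
    field_simp
    linear_combination key
  rw [h1, h2, one_div_one_div, one_div_one_div]
  exact ⟨rfl, rfl⟩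
end

section
/- Let α > 0 be a real number with α ∉ √2·ℚ, with H₄-expansion data G_n = (t_n, v_n; u_n, w_n), α_n = (w_n·α − v_n)/(t_n − u_n·α), α*_n = w_n/u_n. Suppose n ≥ m(α)+1, t_n/u_n is an H₄-best approximation of α with t_n/u_n ≠ t_{n+1}/u_{n+1}, and let p'/q' be the H₄-best approximation of α consecutive after t_n/u_n (i.e., t_n/u_n and p'/q' are consecutive H₄-best approximations). Then: p'/q' = v_n/w_n if α*_n > 1 and α_n < 1; p'/q' = t_{n+1}/u_{n+1} if α*_n > 1 and 1 ≤ α_n < √2; and p'/q' = v_{n+1}/w_{n+1} if α*_n < 1 and 1 < α_n < √2. -/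
/-- p/q ∈ ℚ(H₄) is an H₄-best approximation of α. -/
def IsBest (α p q : ℝ) : Prop :=
  QH4 p q ∧ ∀ r s : ℝ, QH4 r s → r / s ≠ p / q → s ≤ q → |q * α - p| < |s * α - r|

/-- p/q and p'/q' are consecutive H₄-best approximations of α. -/
def Consecutive (α p q p' q' : ℝ) : Prop :=
  IsBest α p q ∧ IsBest α p' q' ∧ q < q' ∧
    ∀ r s : ℝ, IsBest α r s → ¬ (q < s ∧ s < q')

/-- The first form is closed under multiplication. -/
theorem H4form.mul {p r q s p' r' q' s' : ℝ} (h : H4form p r q s) (h' : H4form p' r' q' s') :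
    H4form (p * p' + r * q') (p * r' + r * s') (q * p' + s * q') (q * r' + s * s') := by
  have h2 : √(2 : ℝ) * √2 = 2 := Real.mul_self_sqrt (by norm_num)
  rcases h with ⟨a, b, c, d, ha, hd, hdet, rfl, rfl, rfl, rfl⟩ |
    ⟨a, b, c, d, hb, hc, hdet, rfl, rfl, rfl, rfl⟩ <;>
  rcases h' with ⟨a', b', c', d', ha', hd', hdet', rfl, rfl, rfl, rfl⟩ |
    ⟨a', b', c', d', hb', hc', hdet', rfl, rfl, rfl, rfl⟩
  · refine Or.inl ⟨a * a' + 2 * (b * c'), a * b' + b * d', c * a' + d * c',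
      d * d' + 2 * (c * b'), (ha.mul ha').add_even (even_two_mul _),
      (hd.mul hd').add_even (even_two_mul _), ?_, ?_, ?_, ?_, ?_⟩
    · linear_combination (a' * d' - 2 * b' * c') * hdet + hdet'
    all_goals push_cast
    · linear_combination (b * c' : ℝ) * h2
    · ring
    · ring
    · linear_combination (c * b' : ℝ) * h2
  · refine Or.inr ⟨a * a' + b * c', a * b' + 2 * (b * d'), d * c' + 2 * (c * a'),
      c * b' + d * d', (ha.mul hb').add_even (even_two_mul _),
      (hd.mul hc').add_even (even_two_mul _), ?_, ?_, ?_, ?_, ?_⟩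
    · linear_combination (2 * a' * d' - b' * c') * hdet + hdet'
    all_goals push_cast
    · ring
    · linear_combination (b * d' : ℝ) * h2
    · linear_combination (c * a' : ℝ) * h2
    · ring
  · refine Or.inr ⟨a * a' + b * c', b * d' + 2 * (a * b'), c * a' + 2 * (d * c'),
      c * b' + d * d', (hb.mul hd').add_even (even_two_mul _),
      (hc.mul ha').add_even (even_two_mul _), ?_, ?_, ?_, ?_, ?_⟩
    · linear_combination (a' * d' - 2 * b' * c') * hdet + hdet'
    all_goals push_cast
    · ring
    · linear_combination (a * b' : ℝ) * h2
    · linear_combination (d * c' : ℝ) * h2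
    · ring
  · refine Or.inl ⟨b * c' + 2 * (a * a'), a * b' + b * d', c * a' + d * c',
      c * b' + 2 * (d * d'), (hb.mul hc').add_even (even_two_mul _),
      (hc.mul hb').add_even (even_two_mul _), ?_, ?_, ?_, ?_, ?_⟩
    · linear_combination (2 * a' * d' - b' * c') * hdet + hdet'
    all_goals push_cast
    · linear_combination (a * a' : ℝ) * h2
    · ring
    · ring
    · linear_combination (d * d' : ℝ) * h2

theorem H4form.det {p r q s : ℝ} (h : H4form p r q s) : p * s - r * q = 1 := by
  have h2 : √(2 : ℝ) * √2 = 2 := Real.mul_self_sqrt (by norm_num)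
  rcases h with ⟨a, b, c, d, ha, hd, hdet, rfl, rfl, rfl, rfl⟩ |
    ⟨a, b, c, d, hb, hc, hdet, rfl, rfl, rfl, rfl⟩
  · have : (a * d - 2 * b * c : ℝ) = 1 := by exact_mod_cast hdet
    linear_combination this - (b * c : ℝ) * h2
  · have : (2 * a * d - b * c : ℝ) = 1 := by exact_mod_cast hdet
    linear_combination this + (a * d : ℝ) * h2

theorem H4form.inv {p r q s : ℝ} (h : H4form p r q s) : H4form s (-r) (-q) p := by
  rcases h with ⟨a, b, c, d, ha, hd, hdet, rfl, rfl, rfl, rfl⟩ |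
    ⟨a, b, c, d, hb, hc, hdet, rfl, rfl, rfl, rfl⟩
  · exact Or.inl ⟨d, -b, -c, a, hd, ha, by linear_combination hdet, by simp⟩
  · exact Or.inr ⟨d, -b, -c, a, hb.neg, hc.neg, by linear_combination hdet, by simp⟩

theorem H4form.swap_columns {p r q s : ℝ} (h : H4form p r q s) : H4form r (-p) s (-q) := by
  rcases h with ⟨a, b, c, d, ha, hd, hdet, rfl, rfl, rfl, rfl⟩ |
    ⟨a, b, c, d, hb, hc, hdet, rfl, rfl, rfl, rfl⟩
  · exact Or.inr ⟨b, -a, d, -c, ha.neg, hd, by linear_combination hdet, by simp⟩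
  · exact Or.inl ⟨b, -a, d, -c, hb, hc.neg, by linear_combination hdet, by simp⟩

theorem H4form.Amat_mem {k : ℕ} (hk : k = 1 ∨ k = 2 ∨ k = 3) :
    H4form (Amat k 0 0) (Amat k 0 1) (Amat k 1 0) (Amat k 1 1) := by
  rcases hk with rfl | rfl | rfl
  · exact Or.inl ⟨1, 0, 1, 1, by decide, by decide, by norm_num, by simp [Amat]⟩
  · exact Or.inr ⟨1, 1, 1, 1, by decide, by decide, by norm_num, by simp [Amat]⟩
  · exact Or.inl ⟨1, 1, 0, 1, by decide, by decide, by norm_num, by simp [Amat]⟩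

theorem Gmat_H4form {d : ℕ → ℕ} (hd : ∀ n : ℕ, 1 ≤ n → d n = 1 ∨ d n = 2 ∨ d n = 3) (n : ℕ) :
    H4form (tn d n) (vn d n) (un d n) (wn d n) := by
  induction n with
  | zero =>
    exact Or.inl ⟨1, 0, 0, 1, by decide, by decide, by norm_num,
      by simp [tn, vn, un, wn, Gmat]⟩
  | succ n ih =>
    have := ih.mul (H4form.Amat_mem (hd (n + 1) (by omega)))
    simpa only [tn, vn, un, wn, Gmat_succ, Matrix.mul_apply, Fin.sum_univ_two] using this

theorem un_nonneg_and_one_le_wn {d : ℕ → ℕ}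
    (hd : ∀ n : ℕ, 1 ≤ n → d n = 1 ∨ d n = 2 ∨ d n = 3) (n : ℕ) :
    0 ≤ un d n ∧ 1 ≤ wn d n := by
  have h2 : 1 ≤ √(2 : ℝ) := Real.one_le_sqrt.2 (by norm_num)
  induction n with
  | zero => simp [un, wn, Gmat]
  | succ n ih =>
    obtain ⟨hu, hw⟩ := ih
    simp only [un, wn] at hu hw
    rcases hd (n + 1) (by omega) with h | h | h <;>
      simp only [un, wn, Gmat_succ, Matrix.mul_apply, Fin.sum_univ_two, h] <;>
      simp [Amat] <;> constructor <;> nlinarith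

theorem H4form.mul_H4 {p r q s p' r' q' s' : ℝ} (h : H4form p r q s) (h' : H4 p' r' q' s') :
    H4 (p * p' + r * q') (p * r' + r * s') (q * p' + s * q') (q * r' + s * s') := by
  rcases h' with h' | h'
  · exact Or.inl (h.mul h')
  · exact Or.inr (by convert h.mul h' using 1 <;> ring)

theorem Int.one_le_abs_cast {a : ℤ} (ha : a ≠ 0) : 1 ≤ |(a : ℝ)| := by
  exact_mod_cast Int.one_le_abs ha

theorem H4form.column {x y r s : ℝ} (h : H4form x r y s) :
    (x = 0 ∧ |y| = 1) ∨ (y = 0 ∧ |x| = 1) ∨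
      (∃ a c : ℝ, 1 ≤ |a| ∧ 1 ≤ |c| ∧ x = a ∧ y = √2 * c) ∨
      (∃ a c : ℝ, 1 ≤ |a| ∧ 1 ≤ |c| ∧ x = √2 * a ∧ y = c) := by
  rcases h with ⟨a, b, c, d, ha, hd, hdet, rfl, rfl, rfl, rfl⟩ |
    ⟨a, b, c, d, hb, hc, hdet, rfl, rfl, rfl, rfl⟩
  · have ha0 : a ≠ 0 := by rintro rfl; simp at ha
    by_cases hc0 : c = 0
    · subst hc0
      have : |a| = 1 := Int.isUnit_iff_abs_eq.1 (IsUnit.of_mul_eq_one d (by simpa using hdet))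
      exact Or.inr (Or.inl ⟨by simp, by exact_mod_cast this⟩)
    · exact Or.inr (Or.inr (Or.inl
        ⟨a, c, Int.one_le_abs_cast ha0, Int.one_le_abs_cast hc0, rfl, rfl⟩))
  · have hc0 : c ≠ 0 := by rintro rfl; simp at hc
    by_cases ha0 : a = 0
    · subst ha0
      have : |c| = 1 := Int.isUnit_iff_abs_eq.1
        (IsUnit.of_mul_eq_one (-b) (by linear_combination hdet))
      exact Or.inl ⟨by simp, by exact_mod_cast this⟩
    · exact Or.inr (Or.inr (Or.inr
        ⟨a, c, Int.one_le_abs_cast ha0, Int.one_le_abs_cast hc0, rfl, rfl⟩))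

theorem H4.column {x y r s : ℝ} (h : H4 x r y s) :
    (x = 0 ∧ |y| = 1) ∨ (y = 0 ∧ |x| = 1) ∨
      (∃ a c : ℝ, 1 ≤ |a| ∧ 1 ≤ |c| ∧ x = a ∧ y = √2 * c) ∨
      (∃ a c : ℝ, 1 ≤ |a| ∧ 1 ≤ |c| ∧ x = √2 * a ∧ y = c) := by
  rcases h with h | h
  · exact h.column
  · rcases h.column with ⟨hx, hy⟩ | ⟨hy, hx⟩ | ⟨a, c, ha, hc, hx, hy⟩ | ⟨a, c, ha, hc, hx, hy⟩
    · exact Or.inl ⟨neg_eq_zero.1 hx, by rwa [abs_neg] at hy⟩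
    · exact Or.inr (Or.inl ⟨neg_eq_zero.1 hy, by rwa [abs_neg] at hx⟩)
    · exact Or.inr (Or.inr (Or.inl ⟨-a, -c, by rwa [abs_neg], by rwa [abs_neg],
        by linarith, by linarith⟩))
    · exact Or.inr (Or.inr (Or.inr ⟨-a, -c, by rwa [abs_neg], by rwa [abs_neg],
        by linarith, by linarith⟩))

theorem eq_one_of_mul_add_mul_le {a c u w : ℝ} (ha : 1 ≤ a) (hc : 1 ≤ c) (hu : 0 < u)
    (hw : 0 < w) (h : a * u + c * w ≤ u + w) : a = 1 ∧ c = 1 := by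
  constructor <;> nlinarith [mul_le_mul_of_nonneg_right ha hu.le,
    mul_le_mul_of_nonneg_right hc hw.le]

/-- Off the axes, positive height and error smaller than `e` force both coordinates to be
positive. -/
theorem pos_of_abs_sub_lt {x y u w e f : ℝ} (hu : 0 < u) (hw : 0 < w)
    (he : 0 < e) (hf : 0 < f) (hx : 1 ≤ |x|) (hpos : 0 < x * u + y * w)
    (hlt : |x * e - y * f| < e) : 0 < x ∧ 0 < y := by
  rw [abs_lt] at hlt
  obtain ⟨h₁, h₂⟩ := hlt
  rcases le_abs.1 hx with hx | hx
  · refine ⟨by linarith, ?_⟩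
    by_contra! hy
    nlinarith
  · rcases le_or_gt y 0 with hy | hy <;> nlinarith [mul_pos hf hw]

/-- Primitive vectors of positive height and error smaller than `e` lie in the closed first
quadrant. -/
theorem H4.column_cases {x y r s u w e f : ℝ} (h : H4 x r y s) (hu : 0 < u) (hw : 0 < w)
    (he : 0 < e) (hf : 0 < f) (hpos : 0 < x * u + y * w) (hlt : |x * e - y * f| < e) :
    (x = 0 ∧ y = 1) ∨ (∃ a c : ℝ, 1 ≤ a ∧ 1 ≤ c ∧ x = a ∧ y = √2 * c) ∨
      (∃ a c : ℝ, 1 ≤ a ∧ 1 ≤ c ∧ x = √2 * a ∧ y = c) := by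
  have h1 : 1 < √(2 : ℝ) := Real.lt_sqrt_of_sq_lt (by norm_num)
  have h0 : 0 < √(2 : ℝ) := by linarith
  rcases h.column with ⟨rfl, hy⟩ | ⟨rfl, hx⟩ | ⟨a, c, ha, hc, rfl, rfl⟩ | ⟨a, c, ha, hc, rfl, rfl⟩
  · have : 0 < y := by
      rw [zero_mul, zero_add] at hpos
      exact pos_of_mul_pos_left hpos hw.le
    exact Or.inl ⟨rfl, by rwa [abs_of_pos this] at hy⟩
  · rw [zero_mul, sub_zero, abs_mul, hx, abs_of_pos he, one_mul] at hlt
    exact absurd hlt (lt_irrefl e)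
  · obtain ⟨hx, hy⟩ := pos_of_abs_sub_lt hu hw he hf ha hpos hlt
    have hy := pos_of_mul_pos_right hy h0.le
    rw [abs_of_pos hx] at ha
    rw [abs_of_pos hy] at hc
    exact Or.inr (Or.inl ⟨_, _, ha, hc, rfl, rfl⟩)
  · have hx : 1 ≤ |√2 * a| := by
      rw [abs_mul, abs_of_pos h0]
      nlinarith
    obtain ⟨hx, hy⟩ := pos_of_abs_sub_lt hu hw he hf hx hpos hlt
    have hx := pos_of_mul_pos_right hx h0.le
    rw [abs_of_pos hx] at ha
    rw [abs_of_pos hy] at hc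
    exact Or.inr (Or.inr ⟨_, _, ha, hc, rfl, rfl⟩)

/-- The criterion for the next best approximation. -/
theorem Consecutive.eq_of_isolated {α t u P Q p' q' : ℝ}
    (hcons : Consecutive α t u p' q')
    (hunique : ∀ r s, QH4 r s → r / s = t / u → r = t ∧ s = u)
    (hPQ : QH4 P Q) (huQ : u < Q) (herr : |Q * α - P| < |u * α - t|)
    (hiso : ∀ r s, QH4 r s → u < s → s ≤ Q → r / s ≠ P / Q → |u * α - t| ≤ |s * α - r|) :
    p' / q' = P / Q := by
  obtain ⟨hb, hb', hlt, hno⟩ := hcons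
  have hbest : IsBest α P Q := by
    refine ⟨hPQ, fun r s hrs hne hs => ?_⟩
    rcases le_or_gt s u with hsu | hsu
    · by_cases h : r / s = t / u
      · obtain ⟨rfl, rfl⟩ := hunique r s hrs h
        exact herr
      · exact herr.trans (hb.2 r s hrs h hsu)
    · exact herr.trans_le (hiso r s hrs hsu hs hne)
  by_contra hne
  have hqQ : q' ≤ Q := not_lt.1 fun h => hno P Q hbest ⟨huQ, h⟩
  refine (hiso p' q' hb'.1 hlt hqQ hne).not_gt (hb'.2 t u hb.1 (fun h => ?_) hlt.le)
  exact hlt.ne' (hunique p' q' hb'.1 h.symm).2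

theorem next_best_approximation (α : ℝ) (hα : 0 < α) (hirr : NotSqrt2Rat α)
    (d : ℕ → ℕ)
    (hd : ∀ n : ℕ, 1 ≤ n → d n = 1 ∨ d n = 2 ∨ d n = 3)
    (hmem : ∀ n : ℕ, 1 ≤ n → vn d n < wn d n * α ∧ un d n * α < tn d n)
    (m : ℕ) (hm : ∀ n : ℕ, 1 ≤ n → n ≤ m → d n = 3) (hm1 : d (m + 1) ≠ 3)
    (n : ℕ) (hn : m + 1 ≤ n)
    (hbest : IsBest α (tn d n) (un d n))
    (hne : tn d n / un d n ≠ tn d (n + 1) / un d (n + 1))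
    (p' q' : ℝ) (hcons : Consecutive α (tn d n) (un d n) p' q') :
    (1 < alphast d n → alphan d α n < 1 → p' / q' = vn d n / wn d n) ∧
    (1 < alphast d n → 1 ≤ alphan d α n → alphan d α n < Real.sqrt 2 →
      p' / q' = tn d (n + 1) / un d (n + 1)) ∧
    (alphast d n < 1 → 1 < alphan d α n → alphan d α n < Real.sqrt 2 →
      p' / q' = vn d (n + 1) / wn d (n + 1)) := by
  have hform := Gmat_H4form hd n
  have hform' := Gmat_H4form hd (n + 1)
  have hwpos := (un_nonneg_and_one_le_wn hd n).2
  have hu := hbest.1.1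
  obtain ⟨hf, he⟩ := hmem n (by omega)
  obtain ⟨hf', he'⟩ := hmem (n + 1) (by omega)
  have hdn := hd (n + 1) (by omega)
  have ht1 : tn d (n + 1) = tn d n * Amat (d (n + 1)) 0 0 + vn d n * Amat (d (n + 1)) 1 0 := by
    simp [tn, vn, Gmat_succ, Matrix.mul_apply]
  have hv1 : vn d (n + 1) = tn d n * Amat (d (n + 1)) 0 1 + vn d n * Amat (d (n + 1)) 1 1 := by
    simp [tn, vn, Gmat_succ, Matrix.mul_apply]
  have hu1 : un d (n + 1) = un d n * Amat (d (n + 1)) 0 0 + wn d n * Amat (d (n + 1)) 1 0 := by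
    simp [un, wn, Gmat_succ, Matrix.mul_apply]
  have hw1 : wn d (n + 1) = un d n * Amat (d (n + 1)) 0 1 + wn d n * Amat (d (n + 1)) 1 1 := by
    simp [un, wn, Gmat_succ, Matrix.mul_apply]
  unfold alphast alphan
  generalize tn d (n + 1) = t', vn d (n + 1) = v', un d (n + 1) = u', wn d (n + 1) = w' at *
  generalize tn d n = t, vn d n = v, un d n = u, wn d n = w at *
  have hdet := hform.det
  have h2 : √(2 : ℝ) * √2 = 2 := Real.mul_self_sqrt (by norm_num)
  have h1 : 1 < √(2 : ℝ) := Real.lt_sqrt_of_sq_lt (by norm_num)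
  have hw : 0 < w := by linarith
  have herr : |u * α - t| = t - u * α := by rw [abs_of_neg (by linarith)]; ring
  have hunique : ∀ r s, QH4 r s → r / s = t / u → r = t ∧ s = u := by
    rintro r s ⟨hs, r', s', hH⟩ h
    rw [div_eq_div_iff hs.ne' hu.ne'] at h
    have hy : -u * r + t * s = 0 := by linarith
    have hr : r = (w * r + -v * s) * t := by linear_combination -r * hdet - v * h
    have hsx : s = (w * r + -v * s) * u := by linear_combination -s * hdet - w * h
    have hx : 0 < w * r + -v * s := pos_of_mul_pos_left (hsx ▸ hs) hu.le
    have hx1 : w * r + -v * s = 1 := by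
      rcases (hform.inv.mul_H4 hH).column with ⟨hx0, -⟩ | ⟨-, h1⟩ |
        ⟨_, c, _, hc, _, h⟩ | ⟨_, c, _, hc, _, h⟩
      · exact absurd hx0 hx.ne'
      · rwa [abs_of_pos hx] at h1
      · have : c = 0 := by nlinarith
        norm_num [this] at hc
      · have : c = 0 := by linarith
        norm_num [this] at hc
    rw [hx1, one_mul] at hr hsx
    exact ⟨hr, hsx⟩
  have hcases : ∀ r s, QH4 r s → |s * α - r| < |u * α - t| →
      ∃ x y, r = x * t + y * v ∧ s = x * u + y * w ∧
      ((x = 0 ∧ y = 1) ∨ (∃ a c : ℝ, 1 ≤ a ∧ 1 ≤ c ∧ x = a ∧ y = √2 * c) ∨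
      (∃ a c : ℝ, 1 ≤ a ∧ 1 ≤ c ∧ x = √2 * a ∧ y = c)) := by
    rintro r s ⟨hs, r', s', hH⟩ hlt
    have hr : r = (w * r + -v * s) * t + (-u * r + t * s) * v := by
      linear_combination -r * hdet
    have hsx : s = (w * r + -v * s) * u + (-u * r + t * s) * w := by
      linear_combination -s * hdet
    refine ⟨_, _, hr, hsx, (hform.inv.mul_H4 hH).column_cases hu hw (sub_pos.2 he)
      (sub_pos.2 hf) (hsx ▸ hs) ?_⟩
    rw [herr, abs_sub_comm] at hlt
    convert hlt using 2
    linear_combination (r - s * α) * hdet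
  refine ⟨fun hA hB => ?_, fun hA hB hC => ?_, fun hA hB hC => ?_⟩
  · rw [one_lt_div hu] at hA
    rw [div_lt_one (by linarith)] at hB
    refine hcons.eq_of_isolated hunique ⟨hw, _, _, Or.inl hform.swap_columns⟩ hA ?_ ?_
    · rw [herr, abs_of_pos (by linarith)]
      exact hB
    · intro r s hrs hus hs hne
      by_contra! hlt
      obtain ⟨x, y, rfl, rfl, ⟨rfl, rfl⟩ | ⟨a, c, ha, hc, rfl, rfl⟩ |
        ⟨a, c, ha, hc, rfl, rfl⟩⟩ := hcases r s hrs hlt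
      · simp at hne
      · nlinarith [mul_le_mul_of_nonneg_right ha hu.le, mul_le_mul_of_nonneg_right hc hw.le]
      · nlinarith [mul_le_mul_of_nonneg_right ha hu.le, mul_le_mul_of_nonneg_right hc hw.le]
  · rw [one_lt_div hu] at hA
    rw [one_le_div (by linarith)] at hB
    rw [div_lt_iff₀ (by linarith)] at hC
    rcases hdn with h | h | h <;> rw [h] at ht1 hv1 hu1 hw1 <;>
      simp [Amat] at ht1 hv1 hu1 hw1 <;> subst ht1 hv1 hu1 hw1
    · nlinarith
    · refine hcons.eq_of_isolated hunique ⟨by positivity, _, _, Or.inl hform'⟩ ?_ ?_ ?_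
      · nlinarith
      · rw [herr, abs_of_neg (by linarith)]
        nlinarith
      · intro r s hrs hus hs hne
        by_contra! hlt
        obtain ⟨x, y, rfl, rfl, ⟨rfl, rfl⟩ | ⟨a, c, ha, hc, rfl, rfl⟩ |
          ⟨a, c, ha, hc, rfl, rfl⟩⟩ := hcases r s hrs hlt
        · rw [herr, abs_of_pos (by linarith)] at hlt
          linarith
        · nlinarith [mul_le_mul_of_nonneg_right ha hu.le, mul_le_mul_of_nonneg_right hc hw.le]
        · obtain ⟨rfl, rfl⟩ := eq_one_of_mul_add_mul_le ha hc
            (mul_pos hu (zero_lt_one.trans h1)) hw (by linarith)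
          apply hne
          ring
    · exact absurd rfl hne
  · rw [div_lt_one hu] at hA
    rw [one_lt_div (by linarith)] at hB
    rw [div_lt_iff₀ (by linarith)] at hC
    rcases hdn with h | h | h <;> rw [h] at ht1 hv1 hu1 hw1 <;>
      simp [Amat] at ht1 hv1 hu1 hw1 <;> subst ht1 hv1 hu1 hw1
    · nlinarith
    · refine hcons.eq_of_isolated hunique
        ⟨by positivity, _, _, Or.inl hform'.swap_columns⟩ ?_ ?_ ?_
      · nlinarith
      · rw [herr, abs_of_pos (by linarith)]
        nlinarith
      · intro r s hrs hus hs hne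
        by_contra! hlt
        obtain ⟨x, y, rfl, rfl, ⟨rfl, rfl⟩ | ⟨a, c, ha, hc, rfl, rfl⟩ |
          ⟨a, c, ha, hc, rfl, rfl⟩⟩ := hcases r s hrs hlt
        · rw [herr, abs_of_pos (by linarith)] at hlt
          linarith
        · obtain ⟨rfl, rfl⟩ := eq_one_of_mul_add_mul_le ha hc hu
            (mul_pos hw (zero_lt_one.trans h1)) (by linarith)
          apply hne
          ring
        · nlinarith [mul_le_mul_of_nonneg_right ha hu.le, mul_le_mul_of_nonneg_right hc hw.le]
    · exact absurd rfl hne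
end

section
/- For every real number α ∈ (0, ∞) there exists a sequence d : ℕ → {1, 2, 3} such that for every n ≥ 1, writing G_n = A_{d₁}···A_{d_n} with entries G_n = (t_n, v_n; u_n, w_n), one has v_n ≤ w_n·α and u_n·α ≤ t_n (i.e., α lies in the closed interval A_{d₁}···A_{d_n}·[0, ∞]). -/
/-- The digit whose matrix has an inverse mapping the nonnegative vector `(x, y)` to a
nonnegative vector. -/
noncomputable def coneDigit (s : ℝ × ℝ) : ℕ :=
  if √2 * s.1 ≤ s.2 then 1 else if √2 * s.2 ≤ s.1 then 3 else 2

/-- The image of the vector `(x, y)` under the inverse of the matrix of its digit. -/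
noncomputable def coneStep (s : ℝ × ℝ) : ℝ × ℝ :=
  if √2 * s.1 ≤ s.2 then (s.1, s.2 - √2 * s.1)
  else if √2 * s.2 ≤ s.1 then (s.1 - √2 * s.2, s.2)
  else (√2 * s.1 - s.2, √2 * s.2 - s.1)

theorem coneDigit_mem (s : ℝ × ℝ) : coneDigit s = 1 ∨ coneDigit s = 2 ∨ coneDigit s = 3 := by
  unfold coneDigit
  split_ifs <;> simp

theorem coneStep_nonneg {s : ℝ × ℝ} (hs : 0 ≤ s.1 ∧ 0 ≤ s.2) :
    0 ≤ (coneStep s).1 ∧ 0 ≤ (coneStep s).2 := by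
  unfold coneStep
  split_ifs <;> constructor <;> dsimp only <;> linarith [hs.1, hs.2]

theorem coneStep_eq_of_Gmat {d : ℕ → ℕ} {α : ℝ} {n : ℕ} {s : ℝ × ℝ}
    (hs : s = (wn d n * α - vn d n, tn d n - un d n * α)) (hd : d (n + 1) = coneDigit s) :
    coneStep s =
      (wn d (n + 1) * α - vn d (n + 1), tn d (n + 1) - un d (n + 1) * α) := by
  unfold coneDigit at hd
  unfold coneStep
  split_ifs at hd ⊢ <;> subst hs <;> simp only [wn, vn, tn, un, Gmat_succ, hd] <;> ext <;>
    simp [Amat, Matrix.mul_apply, Fin.sum_univ_two] <;> ring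

theorem expansion_exists (α : ℝ) (hα : 0 < α) :
    ∃ d : ℕ → ℕ, (∀ n : ℕ, 1 ≤ n → d n = 1 ∨ d n = 2 ∨ d n = 3) ∧
      ∀ n : ℕ, 1 ≤ n → vn d n ≤ wn d n * α ∧ un d n * α ≤ tn d n := by
  let s : ℕ → ℝ × ℝ := fun n => coneStep^[n] (α, 1)
  have s_succ (n : ℕ) : s (n + 1) = coneStep (s n) := Function.iterate_succ_apply' ..
  have s_nonneg (n : ℕ) : 0 ≤ (s n).1 ∧ 0 ≤ (s n).2 := by
    induction n with
    | zero => exact ⟨hα.le, zero_le_one⟩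
    | succ n ih => exact s_succ n ▸ coneStep_nonneg ih
  let d : ℕ → ℕ := fun n => coneDigit (s (n - 1))
  have s_eq (n : ℕ) : s n = (wn d n * α - vn d n, tn d n - un d n * α) := by
    induction n with
    | zero => simp [s, wn, vn, tn, un, Gmat]
    | succ n ih => exact (s_succ n).trans (coneStep_eq_of_Gmat ih rfl)
  refine ⟨d, fun n _ => coneDigit_mem _, fun n _ => ?_⟩
  have h := s_nonneg n
  rw [s_eq] at h
  exact ⟨sub_nonneg.mp h.1, sub_nonneg.mp h.2⟩
end
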